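/- arXiv:2302.12221 — 5 statements merged into one kernel-verified Lean document; each statement's English description precedes it below -/
import Mathlib

section
/- Let χ be a finite nonempty type equipped with an associative binary operation ⊕, let p be a probability mass function on χ, and let p^{⊛m} denote the m-fold pseudo-convolution of p with itself. If there is a function q : χ → ℝ such that p^{⊛m}(z) converges to q(z) as m → ∞ for every z ∈ χ, then q is a probability mass function satisfying q ⊛ q = q (i.e., the limit distribution is A-stable). -/
open Finset Filter Topology

/-- Pseudo-convolution of two (probability mass) functions with respect to the
binary operation `op`: `(p ⊛ q)(z) = ∑_{(x,y) : x ⊕ y = z} p(x) q(y)`. -/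
noncomputable def pconv {χ : Type*} [Fintype χ] [DecidableEq χ]
    (op : χ → χ → χ) (p q : χ → ℝ) : χ → ℝ :=
  fun z => ∑ x : χ, ∑ y : χ, if op x y = z then p x * q y else 0

/-- `piter op p m` is the `(m+1)`-fold pseudo-convolution `p^{⊛(m+1)}`
(so `piter op p 0 = p^{⊛1} = p`). -/
noncomputable def piter {χ : Type*} [Fintype χ] [DecidableEq χ]
    (op : χ → χ → χ) (p : χ → ℝ) : ℕ → χ → ℝ
  | 0 => p
  | m + 1 => pconv op p (piter op p m)

theorem sum_pconv_mul {χ : Type*} [Fintype χ] [DecidableEq χ] (op : χ → χ → χ)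
    (p q f : χ → ℝ) :
    ∑ w, pconv op p q w * f w = ∑ x, ∑ y, p x * q y * f (op x y) := by
  simp only [pconv, sum_mul]
  rw [sum_comm]
  refine sum_congr rfl fun x _ => ?_
  rw [sum_comm]
  simp [ite_mul]

theorem sum_pconv {χ : Type*} [Fintype χ] [DecidableEq χ] (op : χ → χ → χ) (p q : χ → ℝ) :
    ∑ w, pconv op p q w = (∑ x, p x) * ∑ y, q y := by
  simpa [sum_mul_sum] using sum_pconv_mul op p q 1

theorem pconv_nonneg {χ : Type*} [Fintype χ] [DecidableEq χ] (op : χ → χ → χ)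
    {p q : χ → ℝ} (hp : ∀ x, 0 ≤ p x) (hq : ∀ x, 0 ≤ q x) (z : χ) : 0 ≤ pconv op p q z :=
  sum_nonneg fun x _ => sum_nonneg fun y _ => by
    split_ifs
    exacts [mul_nonneg (hp x) (hq y), le_rfl]

theorem pconv_assoc {χ : Type*} [Fintype χ] [DecidableEq χ] {op : χ → χ → χ}
    (hassoc : ∀ x y z : χ, op (op x y) z = op x (op y z)) (p q r : χ → ℝ) :
    pconv op (pconv op p q) r = pconv op p (pconv op q r) := by
  funext z
  calc pconv op (pconv op p q) r z
      = ∑ w, pconv op p q w * ∑ y, if op w y = z then r y else 0 := by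
        simp only [pconv, mul_sum, mul_ite, mul_zero]
    _ = ∑ x, ∑ u, ∑ v, p x * q u * if op x (op u v) = z then r v else 0 := by
        rw [sum_pconv_mul]
        simp only [hassoc, mul_sum]
    _ = ∑ x, p x * ∑ w, pconv op q r w * if op x w = z then 1 else 0 := by
        simp only [sum_pconv_mul, mul_sum]
        refine sum_congr rfl fun x _ => sum_congr rfl fun u _ => sum_congr rfl fun v _ => ?_
        split_ifs <;> ring
    _ = pconv op p (pconv op q r) z := by
        rw [pconv]
        simp only [mul_sum, mul_ite, mul_one, mul_zero]

theorem piter_nonneg {χ : Type*} [Fintype χ] [DecidableEq χ] (op : χ → χ → χ)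
    {p : χ → ℝ} (hp : ∀ x, 0 ≤ p x) (m : ℕ) (z : χ) : 0 ≤ piter op p m z := by
  induction m generalizing z with
  | zero => exact hp z
  | succ m ih => exact pconv_nonneg op hp ih z

theorem sum_piter {χ : Type*} [Fintype χ] [DecidableEq χ] (op : χ → χ → χ)
    {p : χ → ℝ} (hp : ∑ x, p x = 1) (m : ℕ) : ∑ z, piter op p m z = 1 := by
  induction m with
  | zero => exact hp
  | succ m ih => rw [piter, sum_pconv, hp, ih, one_mul]

theorem pconv_piter {χ : Type*} [Fintype χ] [DecidableEq χ] {op : χ → χ → χ}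
    (hassoc : ∀ x y z : χ, op (op x y) z = op x (op y z)) (p : χ → ℝ) (m n : ℕ) :
    pconv op (piter op p m) (piter op p n) = piter op p (m + n + 1) := by
  induction m with
  | zero => rw [Nat.zero_add]; rfl
  | succ m ih =>
    rw [piter, pconv_assoc hassoc, ih, show m + 1 + n + 1 = m + n + 1 + 1 by omega, ← piter]

theorem tendsto_pconv {ι χ : Type*} [Fintype χ] [DecidableEq χ] (op : χ → χ → χ)
    {l : Filter ι} {f g : ι → χ → ℝ} {p q : χ → ℝ}
    (hf : ∀ z, Tendsto (fun i => f i z) l (𝓝 (p z)))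
    (hg : ∀ z, Tendsto (fun i => g i z) l (𝓝 (q z))) (z : χ) :
    Tendsto (fun i => pconv op (f i) (g i) z) l (𝓝 (pconv op p q z)) := by
  refine tendsto_finsetSum _ fun x _ => tendsto_finsetSum _ fun y _ => ?_
  split_ifs
  exacts [(hf x).mul (hg y), tendsto_const_nhds]

/-- If the pseudo-convolution powers `p^{⊛m}` of a pmf `p` converge pointwise to
some function `q`, then `q` is a pmf and `q ⊛ q = q`, i.e. `q` is `A`-stable. -/
theorem limit_of_pseudo_sums_is_stable {χ : Type*} [Fintype χ] [DecidableEq χ] [Nonempty χ]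
    (op : χ → χ → χ) (hassoc : ∀ x y z : χ, op (op x y) z = op x (op y z))
    (p : χ → ℝ) (hp0 : ∀ x, 0 ≤ p x) (hp1 : ∑ x : χ, p x = 1)
    (q : χ → ℝ)
    (hconv : ∀ z : χ, Tendsto (fun m => piter op p m z) atTop (𝓝 (q z))) :
    (∀ x, 0 ≤ q x) ∧ (∑ x : χ, q x = 1) ∧ pconv op q q = q := by
  refine ⟨fun x => ge_of_tendsto' (hconv x) fun m => piter_nonneg op hp0 m x, ?_, ?_⟩
  · have hsum := tendsto_finsetSum univ fun z _ => hconv z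
    simp only [sum_piter op hp1] at hsum
    exact tendsto_nhds_unique hsum tendsto_const_nhds
  · funext z
    have hsq := tendsto_pconv op hconv hconv z
    simp only [pconv_piter hassoc] at hsq
    have hsub : Tendsto (fun m : ℕ => m + m + 1) atTop atTop :=
      tendsto_atTop_mono (fun m => show m ≤ m + m + 1 by lia) (tendsto_id (α := ℕ))
    exact tendsto_nhds_unique hsq ((hconv z).comp hsub)
end

section
/- Let χ be a finite nonempty type equipped with an associative binary operation ⊕, and let J be a nonempty finite subset of χ such that for every a, b ∈ J the equation x ⊕ a = b has a unique solution x ∈ J. Then the uniform probability mass function u on J (u(x) = 1/|J| for x ∈ J and u(x) = 0 otherwise) satisfies u ⊛ u = u; that is, the uniform distribution on J is A-stable. -/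
open Finset

/-- A finite set on which `x ⊕ a = b` is solvable for all `a, b` is closed under the operation. -/
theorem op_mem_of_forall_exists_solution {χ : Type*} {op : χ → χ → χ} {J : Finset χ}
    (hsolve : ∀ a ∈ J, ∀ b ∈ J, ∃ x ∈ J, op x a = b)
    {x a : χ} (hx : x ∈ J) (ha : a ∈ J) : op x a ∈ J := by
  classical
  have hsub : J ⊆ J.image (fun x => op x a) := fun b hb => by
    obtain ⟨y, hy, hyb⟩ := hsolve a ha b hb
    exact mem_image.2 ⟨y, hy, hyb⟩
  have himage := eq_of_subset_of_card_le hsub card_image_le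
  rw [himage]
  exact mem_image_of_mem _ hx

/-- The translate of the uniform weight on `J` by an element of `J` is again uniform on `J`. -/
theorem sum_uniform_translate {χ : Type*} [DecidableEq χ]
    {op : χ → χ → χ} {J : Finset χ}
    (hsolve : ∀ a ∈ J, ∀ b ∈ J, ∃! x, x ∈ J ∧ op x a = b)
    {a : χ} (ha : a ∈ J) (z : χ) (c : ℝ) :
    (∑ x ∈ J, if op x a = z then c else 0) = if z ∈ J then c else 0 := by
  split_ifs with hz
  · obtain ⟨w, ⟨hw, hwz⟩, huniq⟩ := hsolve a ha z hz
    rw [sum_eq_single_of_mem w hw fun x hx hne => if_neg fun h => hne (huniq x ⟨hx, h⟩),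
      if_pos hwz]
  · refine sum_eq_zero fun x hx => if_neg fun h => hz ?_
    rw [← h]
    exact op_mem_of_forall_exists_solution (fun a ha b hb => (hsolve a ha b hb).exists) hx ha

/-- If on a nonempty finite subset `J` of `χ` a left pseudo-subtraction can be
defined (for every `a, b ∈ J` the equation `x ⊕ a = b` has a unique solution
`x ∈ J`), then the uniform distribution on `J` is `A`-stable. -/
theorem uniform_on_subtractive_set_is_stable {χ : Type*} [Fintype χ] [DecidableEq χ] [Nonempty χ]
    (op : χ → χ → χ) (hassoc : ∀ x y z : χ, op (op x y) z = op x (op y z))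
    (J : Finset χ) (hJ : J.Nonempty)
    (hsolve : ∀ a ∈ J, ∀ b ∈ J, ∃! x, x ∈ J ∧ op x a = b) :
    pconv op (fun x => if x ∈ J then (1 : ℝ) / J.card else 0)
      (fun x => if x ∈ J then (1 : ℝ) / J.card else 0) =
      fun x => if x ∈ J then (1 : ℝ) / J.card else 0 := by
  have hcard : (J.card : ℝ) ≠ 0 := by exact_mod_cast hJ.card_ne_zero
  funext z
  calc
    _ = ∑ y : χ, ∑ x : χ, if y ∈ J then (if x ∈ J then
          (if op x y = z then (1 : ℝ) / J.card * (1 / J.card) else 0) else 0) else 0 := by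
      rw [pconv, sum_comm]
      refine sum_congr rfl fun y _ => sum_congr rfl fun x _ => ?_
      split_ifs <;> simp
    _ = ∑ y ∈ J, ∑ x ∈ J, if op x y = z then (1 : ℝ) / J.card * (1 / J.card) else 0 := by
      simp only [sum_ite_irrel, sum_const_zero, sum_ite_mem, univ_inter]
    _ = ∑ y ∈ J, if z ∈ J then (1 : ℝ) / J.card * (1 / J.card) else 0 :=
      sum_congr rfl fun y hy => sum_uniform_translate hsolve hy z _
    _ = if z ∈ J then (1 : ℝ) / J.card else 0 := by
      rw [sum_const, nsmul_eq_mul]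
      split_ifs
      · field_simp
      · simp
end

section
/- Let N ≥ 1 and let p be a probability mass function on ZMod N. Then p satisfies p * p = p (i.e., p is Z_N-stable) if and only if there exists a positive divisor M of N such that p is the uniform distribution on the subgroup of ZMod N consisting of the multiples of M; explicitly, p(k) = M/N if k is a multiple of M in ZMod N, and p(k) = 0 otherwise. (The case M = N gives the degenerate law at 0.) -/
open Finset
open scoped Classical

/-- Convolution of two (probability mass) functions on `ZMod N`:
`(p * q)(z) = ∑_{(x,y) : x + y = z} p(x) q(y)`. -/
noncomputable def zconv {N : ℕ} [NeZero N] (p q : ZMod N → ℝ) : ZMod N → ℝ :=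
  fun z => ∑ x : ZMod N, ∑ y : ZMod N, if x + y = z then p x * q y else 0

theorem zconv_apply {N : ℕ} [NeZero N] (p q : ZMod N → ℝ) (z : ZMod N) :
    zconv p q z = ∑ x : ZMod N, p x * q (z - x) := by
  unfold zconv
  refine Finset.sum_congr rfl fun x _ => ?_
  simp [← eq_sub_iff_add_eq']

theorem mem_zmultiples_natCast_iff {N : ℕ} [NeZero N] (M : ℕ) (k : ZMod N) :
    k ∈ AddSubgroup.zmultiples (M : ZMod N) ↔ ∃ j : ZMod N, (M : ZMod N) * j = k := by
  rw [AddSubgroup.mem_zmultiples_iff]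
  constructor
  · rintro ⟨n, rfl⟩
    exact ⟨n, by simp [mul_comm]⟩
  · rintro ⟨j, rfl⟩
    exact ⟨j.val, by simp [mul_comm]⟩

theorem exists_dvd_eq_zmultiples {N : ℕ} [NeZero N] (H : AddSubgroup (ZMod N)) :
    ∃ M : ℕ, 0 < M ∧ M ∣ N ∧ H = AddSubgroup.zmultiples (M : ZMod N) := by
  obtain ⟨a, ha⟩ := Int.subgroup_cyclic (H.comap (Int.castAddHom (ZMod N)))
  rw [← AddSubgroup.zmultiples_eq_closure] at ha
  have hmem (n : ℤ) : (n : ZMod N) ∈ H ↔ (a.natAbs : ℤ) ∣ n := by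
    rw [Int.natAbs_dvd, ← Int.mem_zmultiples_iff, ← ha]
    rfl
  have hdvd : a.natAbs ∣ N := by
    have h : ((N : ℤ) : ZMod N) ∈ H := by simp
    exact_mod_cast (hmem N).1 h
  refine ⟨a.natAbs, Nat.pos_of_dvd_of_pos hdvd (NeZero.pos N), hdvd, le_antisymm ?_ ?_⟩
  · intro k hk
    have hk' : ((k.val : ℤ) : ZMod N) ∈ H := by simpa using hk
    obtain ⟨j, hj⟩ := (hmem _).1 hk'
    refine (mem_zmultiples_natCast_iff _ _).2 ⟨(j : ZMod N), ?_⟩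
    have h := congrArg (Int.cast : ℤ → ZMod N) hj
    push_cast at h
    simpa using h.symm
  · rw [AddSubgroup.zmultiples_le]
    have h := (hmem a.natAbs).2 dvd_rfl
    rwa [Int.cast_natCast] at h

theorem card_zmultiples_natCast {N M : ℕ} [NeZero N] (hM : M ∣ N) :
    Nat.card (AddSubgroup.zmultiples (M : ZMod N)) = N / M := by
  rw [Nat.card_zmultiples, ZMod.addOrderOf_coe M (NeZero.ne N), Nat.gcd_eq_right hM]

/-- If `p * p = p`, then reflecting a maximizer of `p` through the support of `p` gives
another maximizer. -/
theorem eq_max_of_zconv_self {N : ℕ} [NeZero N] {p : ZMod N → ℝ}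
    (hp0 : ∀ k, 0 ≤ p k) (hp1 : ∑ k : ZMod N, p k = 1) (h : zconv p p = p)
    {a : ZMod N} (ha : ∀ k, p k ≤ p a) {x : ZMod N} (hx : p x ≠ 0) : p (a - x) = p a := by
  have hsum : ∑ y : ZMod N, p y * p (a - y) = ∑ y : ZMod N, p y * p a := by
    rw [← zconv_apply, h, ← Finset.sum_mul, hp1, one_mul]
  have hle : ∀ y ∈ (Finset.univ : Finset (ZMod N)), p y * p (a - y) ≤ p y * p a :=
    fun y _ => mul_le_mul_of_nonneg_left (ha _) (hp0 y)
  exact mul_left_cancel₀ hx ((Finset.sum_eq_sum_iff_of_le hle).1 hsum x (Finset.mem_univ x))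

/-- A stable probability mass function is uniform on a subgroup. -/
theorem exists_subgroup_of_zconv_self {N : ℕ} [NeZero N] {p : ZMod N → ℝ}
    (hp0 : ∀ k, 0 ≤ p k) (hp1 : ∑ k : ZMod N, p k = 1) (h : zconv p p = p) :
    ∃ H : AddSubgroup (ZMod N), ∀ k, p k = if k ∈ H then p 0 else 0 := by
  obtain ⟨a, ha⟩ := Finite.exists_max p
  have ha0 : p a ≠ 0 := by
    intro h0
    have hz : ∀ k, p k = 0 := fun k => le_antisymm (h0 ▸ ha k) (hp0 k)
    simp [hz] at hp1
  have h0a : p 0 = p a := by simpa using eq_max_of_zconv_self hp0 hp1 h ha ha0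
  have hmax : ∀ k, p k ≤ p 0 := fun k => h0a ▸ ha k
  have h00 : p 0 ≠ 0 := h0a ▸ ha0
  have hneg {x : ZMod N} (hx : p x ≠ 0) : p (-x) = p 0 := by
    simpa using eq_max_of_zconv_self hp0 hp1 h hmax hx
  have hsupp {x : ZMod N} (hx : p x ≠ 0) : p x = p 0 := by
    simpa using hneg (x := -x) (by rwa [hneg hx])
  let H : AddSubgroup (ZMod N) :=
    { carrier := {x | p x ≠ 0}
      zero_mem' := h00
      neg_mem' := fun {x} hx => by
        simpa [hneg hx] using h00
      add_mem' := fun {x y} hx hy => by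
        have hxm : ∀ k, p k ≤ p x := fun k => (hsupp hx).symm ▸ hmax k
        have hy' : p (-y) ≠ 0 := by rwa [hneg hy]
        have hxy := eq_max_of_zconv_self hp0 hp1 h hxm hy'
        rw [sub_neg_eq_add] at hxy
        exact fun hc => hx (hxy ▸ hc) }
  refine ⟨H, fun k => ?_⟩
  by_cases hk : p k = 0
  · rw [if_neg (fun hkH : k ∈ H => hkH hk), hk]
  · rw [if_pos (show k ∈ H from hk), hsupp hk]

/-- A pmf `p` on `ZMod N` is `Z_N`-stable (`p * p = p`) if and only if there is a
positive divisor `M` of `N` such that `p` is the uniform distribution on the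
subgroup of multiples of `M` in `ZMod N`: `p(k) = M/N` if `k` is a multiple of
`M`, and `p(k) = 0` otherwise. (The case `M = N` is the degenerate law at `0`.) -/
theorem zmod_stable_iff (N : ℕ) [NeZero N] (p : ZMod N → ℝ)
    (hp0 : ∀ k, 0 ≤ p k) (hp1 : ∑ k : ZMod N, p k = 1) :
    zconv p p = p ↔
      ∃ M : ℕ, 0 < M ∧ M ∣ N ∧
        ∀ k : ZMod N,
          p k = if ∃ j : ZMod N, (M : ZMod N) * j = k then (M : ℝ) / N else 0 := by
  constructor
  · intro h
    obtain ⟨H, hH⟩ := exists_subgroup_of_zconv_self hp0 hp1 h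
    obtain ⟨M, hM, hMN, rfl⟩ := exists_dvd_eq_zmultiples H
    refine ⟨M, hM, hMN, fun k => ?_⟩
    have hcard : (N / M : ℝ) * p 0 = 1 := by
      rw [← hp1, Finset.sum_congr rfl fun k _ => hH k, ← Finset.sum_filter,
        Finset.sum_const, nsmul_eq_mul, ← Nat.cast_div_charZero hMN,
        ← card_zmultiples_natCast hMN, Nat.card_eq_fintype_card, Fintype.card_subtype]
    have hM0 : (M : ℝ) ≠ 0 := by exact_mod_cast hM.ne'
    have hN0 : (N : ℝ) ≠ 0 := by exact_mod_cast NeZero.ne N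
    have hp : p 0 = M / N := by
      field_simp at hcard ⊢
      linarith
    rw [hH k, hp]
    simp only [mem_zmultiples_natCast_iff]
  · rintro ⟨M, -, -, hp⟩
    simp only [← mem_zmultiples_natCast_iff] at hp
    funext z
    have hterm : ∀ x, p x * p (z - x) = p x * p z := by
      intro x
      by_cases hx : x ∈ AddSubgroup.zmultiples (M : ZMod N)
      · rw [hp (z - x), hp z]
        rw [sub_eq_add_neg]
        simp only [AddSubgroup.add_mem_cancel_right _ (neg_mem hx)]
      · simp [hp x, hx]
    rw [zconv_apply, Finset.sum_congr rfl fun x _ => hterm x, ← Finset.sum_mul, hp1, one_mul]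
end

section
/- Let N ≥ 1, let M be a positive divisor of N, set R = N/M, and let u_M be the uniform distribution on the subgroup of ZMod N consisting of multiples of M (u_M(k) = M/N if M divides k, else 0). A probability mass function p on ZMod N satisfies p^{*m} → u_M pointwise as m → ∞ (i.e., p belongs to the domain of attraction of u_M) if and only if p is supported on the multiples of M and the pmf q on ZMod R defined by q(k) = p(M·k) satisfies: for every a ∈ ZMod R and every t ∈ ZMod R with t ≠ 0, one has ∑_{y ∈ ZMod R : (y−a)·t = 0 in ZMod R} q(y) < 1. -/
open Finset Filter Topology
open scoped Classical

/-- `ziter p m` is the `m`-fold convolution `p^{*m}`, with `p^{*0} = δ_0`. -/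
noncomputable def ziter {N : ℕ} [NeZero N] (p : ZMod N → ℝ) : ℕ → ZMod N → ℝ
  | 0 => fun z => if z = 0 then 1 else 0
  | m + 1 => zconv p (ziter p m)

/-- A convex combination of points of the unit circle that lies on the unit circle is trivial. -/
theorem eq_sum_of_norm_sum_eq_one {ι : Type*} [Fintype ι] (p : ι → ℝ) (hp0 : ∀ k, 0 ≤ p k)
    (hp1 : ∑ k, p k = 1) (w : ι → ℂ) (hw : ∀ k, ‖w k‖ = 1) (hs : ‖∑ k, w k * p k‖ = 1)
    (k : ι) (hk : p k ≠ 0) : w k = ∑ j, w j * p j := by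
  set s := ∑ j, w j * (p j : ℂ) with hsdef
  have hre (j : ι) : (w j * star s).re ≤ 1 :=
    (Complex.re_le_norm _).trans (by rw [norm_mul, norm_star, hw, hs, one_mul])
  have hss : s * star s = 1 := by
    have := Complex.mul_conj s
    rw [Complex.normSq_eq_norm_sq, hs] at this
    simpa using this
  have hsum : ∑ j, p j * (1 - (w j * star s).re) = 0 := by
    have h1 : ∑ j, p j * (w j * star s).re = 1 := by
      have h2 := congrArg Complex.re hss
      nth_rewrite 1 [hsdef] at h2
      rw [Finset.sum_mul, Complex.re_sum] at h2
      rw [Complex.one_re] at h2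
      rw [← h2]
      refine Finset.sum_congr rfl fun j _ => ?_
      rw [← Complex.re_ofReal_mul]
      congr 1
      ring
    simp only [mul_sub, mul_one, Finset.sum_sub_distrib, hp1, h1, sub_self]
  have hz := (Finset.sum_eq_zero_iff_of_nonneg
    (fun j _ => mul_nonneg (hp0 j) (sub_nonneg.2 (hre j)))).1 hsum k (Finset.mem_univ k)
  have hr : (w k * star s).re = 1 := by
    rcases mul_eq_zero.1 hz with h | h
    · exact absurd h hk
    · linarith
  have hn : ‖w k * star s‖ = 1 := by rw [norm_mul, norm_star, hw, hs, one_mul]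
  have hone : w k * star s = 1 := by
    have h3 : (w k * star s).re ^ 2 + (w k * star s).im ^ 2 = 1 := by
      have := Complex.sq_norm (w k * star s)
      rw [hn, Complex.normSq_apply] at this
      linarith
    refine Complex.ext hr ?_
    rw [hr] at h3
    rw [Complex.one_im]
    exact pow_eq_zero_iff two_ne_zero |>.1 (by linarith)
  calc w k = w k * (s * star s) := by rw [hss, mul_one]
    _ = (w k * star s) * s := by ring
    _ = s := by rw [hone, one_mul]

theorem tendsto_pow_one_iff (z : ℂ) : Tendsto (fun m : ℕ => z ^ m) atTop (𝓝 1) ↔ z = 1 := by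
  refine ⟨fun h => ?_, fun h => by simp [h]⟩
  have h1 := (tendsto_add_atTop_iff_nat 1).2 h
  have h2 := h.mul_const z
  simp only [← pow_succ, one_mul] at h2
  exact tendsto_nhds_unique h2 h1

section Fourier

variable {N : ℕ} [NeZero N]

/-- The discrete Fourier transform of a real function on `ZMod N`. -/
noncomputable def charFn (p : ZMod N → ℝ) : ZMod N → ℂ := ZMod.dft fun k => (p k : ℂ)

theorem charFn_apply (p : ZMod N → ℝ) (t : ZMod N) :
    charFn p t = ∑ k, ZMod.stdAddChar (-(k * t)) * (p k : ℂ) := rfl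

theorem charFn_zconv (p q : ZMod N → ℝ) (t : ZMod N) :
    charFn (zconv p q) t = charFn p t * charFn q t := by
  have hz (z : ZMod N) : zconv p q z = ∑ x, p x * q (z - x) := by
    refine Finset.sum_congr rfl fun x _ => ?_
    simp only [← eq_sub_iff_add_eq']
    simp
  simp only [charFn_apply, hz, Complex.ofReal_sum]
  rw [Finset.sum_mul]
  simp only [Finset.mul_sum]
  rw [Finset.sum_comm]
  refine Finset.sum_congr rfl fun x _ => ?_
  rw [← Equiv.sum_comp (Equiv.addRight x)]
  refine Finset.sum_congr rfl fun y _ => ?_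
  have : -((y + x) * t) = -(x * t) + -(y * t) := by ring
  simp only [Equiv.coe_addRight, add_sub_cancel_right, this, AddChar.map_add_eq_mul,
    Complex.ofReal_mul]
  ring

theorem charFn_ziter (p : ZMod N → ℝ) (m : ℕ) (t : ZMod N) :
    charFn (ziter p m) t = charFn p t ^ m := by
  induction m with
  | zero => simp [charFn_apply, ziter, apply_ite Complex.ofReal]
  | succ m ih => rw [ziter, charFn_zconv, ih, pow_succ']

theorem tendsto_iff_tendsto_charFn (f : ℕ → ZMod N → ℝ) (g : ZMod N → ℝ) :
    (∀ z, Tendsto (fun m => f m z) atTop (𝓝 (g z))) ↔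
      ∀ t, Tendsto (fun m => charFn (f m) t) atTop (𝓝 (charFn g t)) := by
  have h1 : Continuous (ZMod.dft : (ZMod N → ℂ) ≃ₗ[ℂ] (ZMod N → ℂ)) :=
    LinearMap.continuous_of_finiteDimensional
      (ZMod.dft : (ZMod N → ℂ) ≃ₗ[ℂ] (ZMod N → ℂ)).toLinearMap
  have h2 : Continuous (ZMod.dft : (ZMod N → ℂ) ≃ₗ[ℂ] (ZMod N → ℂ)).symm :=
    LinearMap.continuous_of_finiteDimensional
      (ZMod.dft : (ZMod N → ℂ) ≃ₗ[ℂ] (ZMod N → ℂ)).symm.toLinearMap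
  rw [← tendsto_pi_nhds (f := fun m => charFn (f m))]
  constructor
  · intro h
    refine (h1.tendsto _).comp (tendsto_pi_nhds.2 fun z => ?_)
    exact Filter.tendsto_ofReal_iff.2 (h z)
  · intro h z
    have h3 := tendsto_pi_nhds.1 ((h2.tendsto _).comp h) z
    simp only [Function.comp_def, charFn, LinearEquiv.symm_apply_apply] at h3
    exact Filter.tendsto_ofReal_iff.1 h3

theorem charFn_eq_one_iff (p : ZMod N → ℝ) (hp0 : ∀ k, 0 ≤ p k) (hp1 : ∑ k, p k = 1)
    (t : ZMod N) : charFn p t = 1 ↔ ∀ k, p k ≠ 0 → k * t = 0 := by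
  constructor
  · intro h k hk
    have h1 := eq_sum_of_norm_sum_eq_one p hp0 hp1 (fun k => ZMod.stdAddChar (-(k * t)))
      (fun k => AddChar.norm_apply _ _) (by rw [← charFn_apply, h, norm_one]) k hk
    rw [← charFn_apply, h, ← AddChar.map_zero_eq_one (ZMod.stdAddChar (N := N))] at h1
    exact neg_eq_zero.1 (ZMod.injective_stdAddChar h1)
  · intro h
    rw [charFn_apply, ← Complex.ofReal_one, ← hp1, Complex.ofReal_sum]
    refine Finset.sum_congr rfl fun k _ => ?_
    by_cases hk : p k = 0
    · simp [hk]
    · simp [h k hk]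

theorem norm_charFn_lt_one_iff (p : ZMod N → ℝ) (hp0 : ∀ k, 0 ≤ p k) (hp1 : ∑ k, p k = 1)
    (t : ZMod N) :
    ‖charFn p t‖ < 1 ↔ ∃ j k, p j ≠ 0 ∧ p k ≠ 0 ∧ (j - k) * t ≠ 0 := by
  constructor
  · contrapose!
    intro h
    obtain ⟨a, -, ha⟩ := Finset.exists_ne_zero_of_sum_ne_zero (hp1.trans_ne one_ne_zero)
    have : charFn p t = ZMod.stdAddChar (-(a * t)) := by
      rw [charFn_apply, ← mul_one (ZMod.stdAddChar (-(a * t))), ← Complex.ofReal_one, ← hp1,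
        Complex.ofReal_sum, Finset.mul_sum]
      refine Finset.sum_congr rfl fun k _ => ?_
      by_cases hk : p k = 0
      · simp [hk]
      · rw [sub_eq_zero.1 ((sub_mul k a t).symm.trans (h k a hk ha))]
    rw [this, AddChar.norm_apply]
  · rintro ⟨j, k, hj, hk, h⟩
    refine lt_of_le_of_ne ?_ fun h1 => h ?_
    · rw [charFn_apply]
      refine (norm_sum_le _ _).trans (le_of_eq ?_)
      rw [← hp1]
      refine Finset.sum_congr rfl fun k _ => ?_
      rw [norm_mul, AddChar.norm_apply, one_mul, Complex.norm_of_nonneg (hp0 k)]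
    · have h2 := eq_sum_of_norm_sum_eq_one p hp0 hp1 (fun k => ZMod.stdAddChar (-(k * t)))
        (fun k => AddChar.norm_apply _ _) (by rwa [← charFn_apply])
      have h3 := neg_inj.1 (ZMod.injective_stdAddChar ((h2 j hj).trans (h2 k hk).symm))
      rw [sub_mul, h3, sub_self]

end Fourier

section Multiples

variable {M R : ℕ} [NeZero (M * R)]

theorem sum_eq_sum_range_multiples (f : ZMod (M * R) → ℝ)
    (hf : ∀ k : ZMod (M * R), (¬ ∃ j : ZMod (M * R), (M : ZMod (M * R)) * j = k) → f k = 0) :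
    ∑ k, f k = ∑ y ∈ Finset.range R, f ((M * y : ℕ) : ZMod (M * R)) := by
  have hM : 0 < M := Nat.pos_of_ne_zero (left_ne_zero_of_mul (NeZero.ne (M * R)))
  symm
  rw [← Finset.sum_image (g := fun y : ℕ => ((M * y : ℕ) : ZMod (M * R))) (f := f)]
  · refine Finset.sum_subset (Finset.subset_univ _) fun k _ hk => hf k ?_
    rintro ⟨j, rfl⟩
    refine hk (Finset.mem_image.2 ⟨j.val % R, ?_, ?_⟩)
    · exact Finset.mem_range.2 (Nat.mod_lt _
        (Nat.pos_of_ne_zero (right_ne_zero_of_mul (NeZero.ne (M * R)))))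
    · rw [← ZMod.natCast_zmod_val j, ← Nat.cast_mul, ZMod.natCast_eq_natCast_iff,
        ZMod.natCast_zmod_val]
      exact (Nat.mod_modEq _ _).mul_left' M
  · intro x hx y hy hxy
    simp only [Finset.coe_range, Set.mem_Iio] at hx hy
    have h := ((ZMod.natCast_eq_natCast_iff _ _ _).1 hxy).mul_left_cancel' hM.ne'
    exact Nat.ModEq.eq_of_lt_of_lt h hx hy

theorem intCast_mul_eq_zero_iff (a : ℤ) :
    ((M * a : ℤ) : ZMod (M * R)) = 0 ↔ (a : ZMod R) = 0 := by
  have hM : (M : ℤ) ≠ 0 := by exact_mod_cast left_ne_zero_of_mul (NeZero.ne (M * R))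
  rw [ZMod.intCast_zmod_eq_zero_iff_dvd, ZMod.intCast_zmod_eq_zero_iff_dvd, Nat.cast_mul,
    mul_dvd_mul_iff_left hM]

/-- The uniform distribution on the multiples of `M` in `ZMod (M * R)`. -/
noncomputable def uniformMultiples (M R : ℕ) [NeZero (M * R)] (z : ZMod (M * R)) : ℝ :=
  if ∃ j : ZMod (M * R), (M : ZMod (M * R)) * j = z then (M : ℝ) / (M * R : ℕ) else 0

theorem charFn_uniformMultiples (t : ZMod (M * R)) :
    charFn (uniformMultiples M R) t = if (M : ZMod (M * R)) * t = 0 then 1 else 0 := by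
  have hMR : (M : ℝ) * R ≠ 0 := by exact_mod_cast NeZero.ne (M * R)
  have h0 (k : ZMod (M * R)) : 0 ≤ uniformMultiples M R k := by
    unfold uniformMultiples
    split_ifs <;> positivity
  have h1 : ∑ k, uniformMultiples M R k = 1 := by
    rw [sum_eq_sum_range_multiples (uniformMultiples M R) fun k hk => if_neg hk]
    have (y : ℕ) : uniformMultiples M R ((M * y : ℕ) : ZMod (M * R)) = (M : ℝ) / (M * R : ℕ) :=
      if_pos ⟨y, by push_cast; rfl⟩
    rw [Finset.sum_congr rfl fun y _ => this y, Finset.sum_const, Finset.card_range, nsmul_eq_mul,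
      Nat.cast_mul, mul_div_assoc', mul_comm, div_self hMR]
  split_ifs with ht
  · rw [charFn_eq_one_iff _ h0 h1]
    intro k hk
    obtain ⟨j, rfl⟩ : ∃ j : ZMod (M * R), (M : ZMod (M * R)) * j = k := by
      by_contra h
      exact hk (if_neg h)
    rw [mul_right_comm, ht, zero_mul]
  · have hshift (k : ZMod (M * R)) :
        uniformMultiples M R (k + M) = uniformMultiples M R k := by
      unfold uniformMultiples
      congr 1
      refine propext ⟨?_, ?_⟩
      · rintro ⟨j, hj⟩
        exact ⟨j - 1, by rw [mul_sub, hj]; ring⟩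
      · rintro ⟨j, hj⟩
        exact ⟨j + 1, by rw [mul_add, hj]; ring⟩
    have hmul : charFn (uniformMultiples M R) t =
        ZMod.stdAddChar (-((M : ZMod (M * R)) * t)) * charFn (uniformMultiples M R) t := by
      nth_rewrite 1 [charFn_apply]
      rw [← Equiv.sum_comp (Equiv.addRight (M : ZMod (M * R))), charFn_apply, Finset.mul_sum]
      refine Finset.sum_congr rfl fun k _ => ?_
      have : -((k + (M : ZMod (M * R))) * t) = -((M : ZMod (M * R)) * t) + -(k * t) := by ring
      simp only [Equiv.coe_addRight, hshift, this, AddChar.map_add_eq_mul, mul_assoc]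
    by_contra hne
    have hone := mul_right_cancel₀ hne ((one_mul _).trans hmul)
    rw [← AddChar.map_zero_eq_one (ZMod.stdAddChar (N := M * R))] at hone
    exact ht (neg_eq_zero.1 (ZMod.injective_stdAddChar hone).symm)

theorem tendsto_ziter_uniformMultiples_iff (p : ZMod (M * R) → ℝ) (hp0 : ∀ k, 0 ≤ p k)
    (hp1 : ∑ k, p k = 1) :
    (∀ z, Tendsto (fun m => ziter p m z) atTop (𝓝 (uniformMultiples M R z))) ↔
      (∀ t : ZMod (M * R), (M : ZMod (M * R)) * t = 0 → ∀ k, p k ≠ 0 → k * t = 0) ∧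
      ∀ t : ZMod (M * R), (M : ZMod (M * R)) * t ≠ 0 →
        ∃ j k, p j ≠ 0 ∧ p k ≠ 0 ∧ (j - k) * t ≠ 0 := by
  rw [tendsto_iff_tendsto_charFn, ← forall_and]
  refine forall_congr' fun t => ?_
  simp only [charFn_ziter, charFn_uniformMultiples]
  by_cases ht : (M : ZMod (M * R)) * t = 0
  · simp only [ht, if_true, tendsto_pow_one_iff, charFn_eq_one_iff p hp0 hp1, ne_eq,
      not_true_eq_false, forall_const, false_imp_iff, and_true]
  · simp only [ht, if_false, tendsto_pow_atTop_nhds_zero_iff_norm_lt_one,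
      norm_charFn_lt_one_iff p hp0 hp1, ne_eq, not_false_eq_true, forall_const, false_imp_iff,
      true_and]

theorem supported_on_multiples_iff (p : ZMod (M * R) → ℝ) :
    (∀ t : ZMod (M * R), (M : ZMod (M * R)) * t = 0 → ∀ k, p k ≠ 0 → k * t = 0) ↔
      ∀ k : ZMod (M * R), (¬ ∃ j : ZMod (M * R), (M : ZMod (M * R)) * j = k) → p k = 0 := by
  constructor
  · intro h k hk
    by_contra hpk
    have hkR := h R (by rw [← Nat.cast_mul, ZMod.natCast_self]) k hpk
    rw [← ZMod.natCast_zmod_val k, ← Nat.cast_mul, ZMod.natCast_eq_zero_iff] at hkR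
    obtain ⟨j, hj⟩ := Nat.dvd_of_mul_dvd_mul_right
      (Nat.pos_of_ne_zero (right_ne_zero_of_mul (NeZero.ne (M * R)))) hkR
    exact hk ⟨j, by rw [← Nat.cast_mul, ← hj, ZMod.natCast_zmod_val]⟩
  · intro h t ht k hpk
    obtain ⟨j, rfl⟩ := not_imp_comm.1 (h k) hpk
    rw [mul_right_comm, ht, zero_mul]

theorem exists_sub_mul_ne_zero_iff (p : ZMod (M * R) → ℝ) (hp0 : ∀ k, 0 ≤ p k)
    (hp1 : ∑ k, p k = 1)
    (hp : ∀ k : ZMod (M * R), (¬ ∃ j : ZMod (M * R), (M : ZMod (M * R)) * j = k) → p k = 0) :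
    (∀ t : ZMod (M * R), (M : ZMod (M * R)) * t ≠ 0 →
        ∃ j k, p j ≠ 0 ∧ p k ≠ 0 ∧ (j - k) * t ≠ 0) ↔
      ∀ a t : ZMod R, t ≠ 0 →
        ∑ y ∈ Finset.range R,
          (if ((y : ZMod R) - a) * t = 0 then p ((M * y : ℕ) : ZMod (M * R)) else 0) < 1 := by
  have hq1 := (sum_eq_sum_range_multiples p hp).symm.trans hp1
  have hrep (k : ZMod (M * R)) (hk : p k ≠ 0) :
      ∃ y ∈ Finset.range R, k = ((M * y : ℕ) : ZMod (M * R)) := by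
    by_contra! h
    have h1 := sum_eq_sum_range_multiples (fun z => if z = k then p k else 0) (fun z hz => by
      simp only [ite_eq_right_iff]
      rintro rfl
      exact hp _ hz)
    rw [Finset.sum_ite_eq' Finset.univ k, if_pos (Finset.mem_univ k),
      Finset.sum_eq_zero fun y hy => if_neg fun hyk => h y hy hyk.symm] at h1
    exact hk h1
  have htrans (x y : ℕ) (s : ℤ) :
      (((M * x : ℕ) : ZMod (M * R)) - ((M * y : ℕ) : ZMod (M * R))) * (s : ZMod (M * R)) = 0 ↔
        ((x : ZMod R) - y) * (s : ZMod R) = 0 := by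
    rw [← Int.cast_natCast x (R := ZMod R), ← Int.cast_natCast y (R := ZMod R), ← Int.cast_sub,
      ← Int.cast_mul, ← intCast_mul_eq_zero_iff (M := M)]
    push_cast
    rw [← mul_sub, mul_assoc]
  have hlt (a t : ZMod R) : ∑ y ∈ Finset.range R,
        (if ((y : ZMod R) - a) * t = 0 then p ((M * y : ℕ) : ZMod (M * R)) else 0) < 1 ↔
      ∃ y ∈ Finset.range R, p ((M * y : ℕ) : ZMod (M * R)) ≠ 0 ∧ ((y : ZMod R) - a) * t ≠ 0 := by
    constructor
    · contrapose!
      intro h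
      rw [← hq1]
      refine Finset.sum_le_sum fun y hy => ?_
      split_ifs with hy0
      · exact le_rfl
      · exact (not_imp_comm.1 (h y hy) hy0).le
    · rintro ⟨y, hy, hpy, hne⟩
      rw [← hq1]
      refine Finset.sum_lt_sum (fun x _ => ?_) ⟨y, hy, ?_⟩
      · split_ifs
        · exact le_rfl
        · exact hp0 _
      · rw [if_neg hne]
        exact lt_of_le_of_ne (hp0 _) hpy.symm
  simp only [hlt]
  constructor
  · intro h a t ht
    obtain ⟨s, rfl⟩ := ZMod.intCast_surjective t
    obtain ⟨j, k, hj, hk, hjk⟩ := h s fun h0 => ht <|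
      (intCast_mul_eq_zero_iff (M := M) s).1 (by push_cast; exact h0)
    obtain ⟨x, hx, rfl⟩ := hrep j hj
    obtain ⟨y, hy, rfl⟩ := hrep k hk
    rw [ne_eq, htrans] at hjk
    by_contra! hall
    refine hjk ?_
    rw [← sub_sub_sub_cancel_right _ _ a, sub_mul, hall x hx hj, hall y hy hk, sub_zero]
  · intro h t ht
    obtain ⟨s, rfl⟩ := ZMod.intCast_surjective t
    obtain ⟨k, -, hk⟩ := Finset.exists_ne_zero_of_sum_ne_zero (hp1.trans_ne one_ne_zero)
    obtain ⟨y, hy, rfl⟩ := hrep k hk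
    obtain ⟨x, hx, hpx, hne⟩ := h y s fun h0 => ht <| by
      simpa using (intCast_mul_eq_zero_iff (M := M) s).2 h0
    exact ⟨_, _, hpx, hk, by rwa [ne_eq, htrans]⟩

end Multiples

/-- Let `M` be a positive divisor of `N`, `R = N/M`, and let `u_M` be the uniform
distribution on the multiples of `M` in `ZMod N`. A pmf `p` on `ZMod N` belongs
to the domain of attraction of `u_M` (its convolution powers `p^{*m}` converge
pointwise to `u_M`) if and only if `p` is supported on the multiples of `M` and
the induced pmf `q(k) = p(M·k)` on `ZMod R` satisfies
`∑_{y : (y-a)·t = 0 in ZMod R} q(y) < 1` for every `a ∈ ZMod R` and every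
`t ∈ ZMod R`, `t ≠ 0`. -/
theorem domain_of_attraction_uniform_on_multiples
    (N : ℕ) [NeZero N] (M : ℕ) (hM : 0 < M) (hMN : M ∣ N) (R : ℕ) (hR : R = N / M)
    (p : ZMod N → ℝ) (hp0 : ∀ k, 0 ≤ p k) (hp1 : ∑ k : ZMod N, p k = 1) :
    (∀ z : ZMod N,
        Tendsto (fun m => ziter p m z) atTop
          (𝓝 (if ∃ j : ZMod N, (M : ZMod N) * j = z then (M : ℝ) / N else 0))) ↔
      ((∀ k : ZMod N, (¬ ∃ j : ZMod N, (M : ZMod N) * j = k) → p k = 0) ∧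
        ∀ a t : ZMod R, t ≠ 0 →
          ∑ y ∈ Finset.range R,
              (if ((y : ZMod R) - a) * t = 0 then p ((M * y : ℕ) : ZMod N) else 0) < 1) := by
  obtain rfl : N = M * R := by rw [hR, Nat.mul_div_cancel' hMN]
  clear hR
  refine (tendsto_ziter_uniformMultiples_iff p hp0 hp1).trans ?_
  rw [supported_on_multiples_iff]
  exact and_congr_right fun h => exists_sub_mul_ne_zero_iff p hp0 hp1 h
end

section
/- Let χ be a finite nonempty linearly ordered type and let p be any probability mass function on χ. Then p is infinitely divisible with respect to the maximum operation: for every n ≥ 1 there exists a probability mass function q on χ whose n-fold max-convolution equals p, namely the pmf whose cumulative distribution function is F_n(x) = (F(x))^{1/n}, where F is the cumulative distribution function of p. -/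
open Finset

/-- Max-convolution of two (probability mass) functions on a linearly ordered
type: `(p ⊛ q)(z) = ∑_{(x,y) : max(x,y) = z} p(x) q(y)`. -/
noncomputable def maxconv {χ : Type*} [Fintype χ] [LinearOrder χ]
    (p q : χ → ℝ) : χ → ℝ :=
  fun z => ∑ x : χ, ∑ y : χ, if max x y = z then p x * q y else 0

/-- `maxiter p m` is the `(m+1)`-fold max-convolution `p^{⊛(m+1)}`
(so `maxiter p 0 = p^{⊛1} = p`). -/
noncomputable def maxiter {χ : Type*} [Fintype χ] [LinearOrder χ]
    (p : χ → ℝ) : ℕ → χ → ℝ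
  | 0 => p
  | m + 1 => maxconv p (maxiter p m)

theorem filter_le_eq_insert_filter_lt {χ : Type*} [Fintype χ] [LinearOrder χ] (x : χ) :
    univ.filter (· ≤ x) = insert x (univ.filter (· < x)) := by
  ext y
  simp [le_iff_eq_or_lt]

theorem sum_filter_le_eq_add_sum_filter_lt {χ : Type*} [Fintype χ] [LinearOrder χ]
    (p : χ → ℝ) (x : χ) :
    ∑ y with y ≤ x, p y = p x + ∑ y with y < x, p y := by
  rw [filter_le_eq_insert_filter_lt, sum_insert (by simp)]

/-- A function on a finite linear order is determined by its cumulative sums. -/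
theorem eq_of_sum_filter_le_eq {χ : Type*} [Fintype χ] [LinearOrder χ] {p q : χ → ℝ}
    (h : ∀ x, ∑ y with y ≤ x, p y = ∑ y with y ≤ x, q y) : p = q := by
  funext x
  induction x using WellFoundedLT.induction with
  | ind x ih =>
    have hx := h x
    rw [sum_filter_le_eq_add_sum_filter_lt, sum_filter_le_eq_add_sum_filter_lt,
      sum_congr rfl fun y hy => ih y (mem_filter.1 hy).2] at hx
    exact add_right_cancel hx

/-- The increments of `φ` along the cumulative sums of `p` telescope over lower sets. -/
theorem sum_increments_of_isLowerSet {χ : Type*} [Fintype χ] [LinearOrder χ]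
    (p : χ → ℝ) {φ : ℝ → ℝ} (hφ : φ 0 = 0) (s : Finset χ) (hs : IsLowerSet (s : Set χ)) :
    ∑ x ∈ s, (φ (∑ y with y ≤ x, p y) - φ (∑ y with y < x, p y)) = φ (∑ x ∈ s, p x) := by
  induction s using Finset.induction_on_max with
  | empty => simp [hφ]
  | insert a s ha ih =>
    have hlt : s = univ.filter (· < a) := by
      ext y
      refine ⟨fun hy => by simpa using ha y hy, fun hy => ?_⟩
      have hya : y < a := by simpa using hy
      have hmem : y ∈ insert a s := by
        exact_mod_cast hs hya.le (by simp : a ∈ (↑(insert a s) : Set χ))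
      exact (mem_insert.1 hmem).resolve_left hya.ne
    have hlow : IsLowerSet (s : Set χ) := by
      intro x y hyx hx
      rw [hlt] at hx ⊢
      simp only [coe_filter, mem_univ, true_and, Set.mem_ofPred_eq] at hx ⊢
      exact hyx.trans_lt hx
    rw [sum_insert fun h => (ha a h).false, ih hlow, filter_le_eq_insert_filter_lt, ← hlt,
      sub_add_cancel]

/-- The cumulative sums of a max-convolution are the products of the cumulative sums. -/
theorem sum_filter_le_maxconv {χ : Type*} [Fintype χ] [LinearOrder χ] (p q : χ → ℝ) (x : χ) :
    ∑ z with z ≤ x, maxconv p q z = (∑ y with y ≤ x, p y) * ∑ y with y ≤ x, q y := by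
  simp only [maxconv]
  rw [sum_comm, sum_mul_sum, sum_filter]
  refine sum_congr rfl fun a _ => ?_
  rw [sum_comm, sum_filter]
  simp only [sum_ite_eq, mem_filter, mem_univ, true_and, max_le_iff]
  by_cases h : a ≤ x <;> simp [h]

theorem sum_filter_le_maxiter {χ : Type*} [Fintype χ] [LinearOrder χ] (p : χ → ℝ) (n : ℕ) (x : χ) :
    ∑ z with z ≤ x, maxiter p n z = (∑ y with y ≤ x, p y) ^ (n + 1) := by
  induction n with
  | zero => simp [maxiter]
  | succ n ih => rw [maxiter, sum_filter_le_maxconv, ih, ← pow_succ']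

/-- Every pmf `p` on a finite nonempty linearly ordered type is infinitely
divisible with respect to the maximum operation: for every `n ≥ 1` (here
`n + 1`, ranging over all integers `≥ 1`) there exists a pmf `q` whose `n`-fold
max-convolution equals `p`, namely the pmf whose cumulative distribution
function is `F_q(x) = (F_p(x))^{1/n}`. -/
theorem max_infinitely_divisible {χ : Type*} [Fintype χ] [LinearOrder χ] [Nonempty χ]
    (p : χ → ℝ) (hp0 : ∀ x, 0 ≤ p x) (hp1 : ∑ x : χ, p x = 1) (n : ℕ) :
    ∃ q : χ → ℝ, (∀ x, 0 ≤ q x) ∧ (∑ x : χ, q x = 1) ∧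
      (∀ x : χ, ∑ y : χ, (if y ≤ x then q y else 0) =
        (∑ y : χ, (if y ≤ x then p y else 0)) ^ (((n : ℝ) + 1)⁻¹)) ∧
      maxiter q n = p := by
  have ha : (0 : ℝ) < ((n : ℝ) + 1)⁻¹ := by positivity
  have hsum := sum_increments_of_isLowerSet p (φ := fun t => t ^ ((n : ℝ) + 1)⁻¹)
    (Real.zero_rpow ha.ne')
  have hcdf : ∀ x : χ, _ := fun x => hsum (univ.filter (· ≤ x))
    (fun _ _ hba hax => by simpa using hba.trans (by simpa using hax))
  refine ⟨fun x => (∑ y with y ≤ x, p y) ^ ((n : ℝ) + 1)⁻¹ -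
    (∑ y with y < x, p y) ^ ((n : ℝ) + 1)⁻¹, fun x => ?_, ?_, fun x => ?_, ?_⟩
  · refine sub_nonneg.2 (Real.rpow_le_rpow (sum_nonneg fun y _ => hp0 y) ?_ ha.le)
    rw [sum_filter_le_eq_add_sum_filter_lt]
    exact le_add_of_nonneg_left (hp0 x)
  · simpa [hp1] using hsum univ (by simp [isLowerSet_univ])
  · rw [← sum_filter, ← sum_filter]
    exact hcdf x
  · refine eq_of_sum_filter_le_eq fun x => ?_
    rw [sum_filter_le_maxiter, hcdf x]
    exact_mod_cast Real.rpow_inv_natCast_pow (sum_nonneg fun y _ => hp0 y) n.succ_ne_zero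
end
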